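/- arXiv:hep-th/0306169 — 3 statements merged into one kernel-verified Lean document; each statement's English description precedes it below -/
import Mathlib

section
/- Fix m > 0 and β > 0. For every natural number n there exists a constant C > 0 such that the n-th iterated (total) derivative of the matter piece G_mat is bounded in norm by C at every point of ℝ × ℝ³; i.e., all derivatives of G_mat of all orders are bounded functions on ℝ × ℝ³. -/
open MeasureTheory RealInnerProductSpace

/-- The Fourier integral of a function with integrable moments has bounded derivatives. -/
lemma exists_norm_iteratedFDeriv_fourierIntegral_le
    {V W E : Type*} [NormedAddCommGroup V] [NormedSpace ℝ V] [NormedAddCommGroup W]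
    [NormedSpace ℝ W] [NormedAddCommGroup E] [NormedSpace ℂ E] [MeasurableSpace V]
    [BorelSpace V] [SecondCountableTopology V] {μ : Measure V} (L : V →L[ℝ] W →L[ℝ] ℝ)
    {f : V → E} (hf : ∀ n : ℕ, Integrable (fun v ↦ ‖v‖ ^ n * ‖f v‖) μ)
    (h'f : AEStronglyMeasurable f μ) (n : ℕ) :
    ∃ C : ℝ, 0 < C ∧ ∀ w, ‖iteratedFDeriv ℝ n
      (VectorFourier.fourierIntegral Real.fourierChar μ L.toLinearMap₁₂ f) w‖ ≤ C := by
  refine ⟨(∫ v, ‖VectorFourier.fourierPowSMulRight L f v n‖ ∂μ) + 1, by positivity, fun w ↦ ?_⟩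
  rw [VectorFourier.iteratedFDeriv_fourierIntegral (N := ⊤) L (fun k _ ↦ hf k) h'f le_top]
  exact (VectorFourier.norm_fourierIntegral_le_integral_norm _ _ _ _ _).trans (by linarith)

/-- Polynomial moments of the Bose–Einstein weight decay like `E ^ (-4)`, uniformly away from
zero energy. -/
lemma exists_pow_mul_boseEinstein_le {m β : ℝ} (hm : 0 < m) (hβ : 0 < β) (n : ℕ) :
    ∃ K : ℝ, 0 ≤ K ∧ ∀ E : ℝ, m ≤ E →
      E ^ n * ((1 / (Real.exp (β * E) - 1)) / (2 * E)) ≤ K * (E ^ 4)⁻¹ := by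
  have hc : 0 < 1 - Real.exp (-(β * m)) := by
    have : Real.exp (-(β * m)) < 1 := by simpa using mul_pos hβ hm
    linarith
  set c := 1 - Real.exp (-(β * m)) with hcdef
  refine ⟨(n + 4).factorial / (β ^ (n + 4) * c * (2 * m)), by positivity, fun E hE ↦ ?_⟩
  have hE0 : 0 < E := hm.trans_le hE
  have hexp : c * ((β * E) ^ (n + 4) / (n + 4).factorial) ≤ Real.exp (β * E) - 1 := by
    have h1 := Real.pow_div_factorial_le_exp (x := β * E) (by positivity) (n + 4)
    have h2 : Real.exp (-(β * m)) * Real.exp (β * E) ≥ 1 := by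
      rw [← Real.exp_add]
      exact Real.one_le_exp (by nlinarith)
    calc c * ((β * E) ^ (n + 4) / (n + 4).factorial) ≤ c * Real.exp (β * E) := by gcongr
      _ ≤ _ := by rw [hcdef]; linarith
  calc E ^ n * ((1 / (Real.exp (β * E) - 1)) / (2 * E))
      ≤ E ^ n * ((1 / (c * ((β * E) ^ (n + 4) / (n + 4).factorial))) / (2 * m)) := by gcongr
    _ = _ := by rw [mul_pow]; field_simp; ring

lemma integrable_pow_mul_boseEinstein {m β : ℝ} (hm : 0 < m) (hβ : 0 < β) (n : ℕ) :
    Integrable (fun k : EuclideanSpace ℝ (Fin 3) ↦ Real.sqrt (‖k‖ ^ 2 + m ^ 2) ^ n *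
      ((1 / (Real.exp (β * Real.sqrt (‖k‖ ^ 2 + m ^ 2)) - 1)) /
        (2 * Real.sqrt (‖k‖ ^ 2 + m ^ 2)))) := by
  obtain ⟨K, hK, hbound⟩ := exists_pow_mul_boseEinstein_le hm hβ n
  have hint : Integrable (fun k : EuclideanSpace ℝ (Fin 3) ↦ (1 + ‖k‖) ^ (-(4 : ℝ))) :=
    integrable_one_add_norm (by simp; norm_num)
  refine (hint.const_mul (K * (1 / m + 1) ^ 4)).mono'
    (Measurable.aestronglyMeasurable (by fun_prop)) (.of_forall fun k ↦ ?_)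
  have hmE : m ≤ Real.sqrt (‖k‖ ^ 2 + m ^ 2) := Real.le_sqrt_of_sq_le (by nlinarith [sq_nonneg ‖k‖])
  have hkE : ‖k‖ ≤ Real.sqrt (‖k‖ ^ 2 + m ^ 2) := Real.le_sqrt_of_sq_le (by nlinarith [sq_nonneg m])
  set E := Real.sqrt (‖k‖ ^ 2 + m ^ 2)
  have hE : 0 < E := hm.trans_le hmE
  have hexp : 0 < Real.exp (β * E) - 1 := by
    have := Real.one_lt_exp_iff.2 (mul_pos hβ hE)
    linarith
  have hrpow : (1 + ‖k‖) ^ (-(4 : ℝ)) = ((1 + ‖k‖) ^ 4)⁻¹ := by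
    rw [Real.rpow_neg (by positivity)]
    norm_cast
  have hle : 1 + ‖k‖ ≤ (1 / m + 1) * E := by
    have : 1 ≤ 1 / m * E := by rw [one_div_mul_eq_div, one_le_div hm]; exact hmE
    linarith
  rw [Real.norm_of_nonneg (by positivity), hrpow]
  refine (hbound E hmE).trans ?_
  rw [mul_assoc]
  gcongr
  rw [← div_eq_mul_inv, le_div_iff₀ (by positivity), inv_mul_le_iff₀ (by positivity),
    mul_comm, ← mul_pow]
  gcongr

/-- The Minkowski pairing on `ℝ × E`, divided by `2π`. -/
noncomputable def minkowskiPairing (E : Type*) [NormedAddCommGroup E] [InnerProductSpace ℝ E] :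
    (ℝ × E) →L[ℝ] (ℝ × E) →L[ℝ] ℝ :=
  let time : (ℝ × E) →L[ℝ] (ℝ × E) →L[ℝ] ℝ :=
    (ContinuousLinearMap.mul ℝ ℝ).bilinearComp (.fst ℝ ℝ E) (.fst ℝ ℝ E)
  let space : (ℝ × E) →L[ℝ] (ℝ × E) →L[ℝ] ℝ :=
    (innerSL ℝ : E →L[ℝ] E →L[ℝ] ℝ).bilinearComp (.snd ℝ ℝ E) (.snd ℝ ℝ E)
  (2 * Real.pi)⁻¹ • (time - space)

lemma minkowskiPairing_apply {E : Type*} [NormedAddCommGroup E] [InnerProductSpace ℝ E]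
    (v w : ℝ × E) :
    minkowskiPairing E v w = (2 * Real.pi)⁻¹ * (v.1 * w.1 - ⟪v.2, w.2⟫) := by
  simp [minkowskiPairing]

lemma fourierChar_neg_minkowskiPairing {E : Type*} [NormedAddCommGroup E] [InnerProductSpace ℝ E]
    (v w : ℝ × E) :
    (Real.fourierChar (-minkowskiPairing E v w) : ℂ) =
      Complex.exp (-Complex.I * ((v.1 * w.1 - ⟪v.2, w.2⟫ : ℝ) : ℂ)) := by
  rw [Real.fourierChar_apply, minkowskiPairing_apply]
  congr 1
  have : (Real.pi : ℂ) ≠ 0 := by exact_mod_cast Real.pi_ne_zero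
  push_cast
  field_simp

/-- For `m > 0` and `β > 0`, every iterated (total) derivative of the
matter piece `G_mat(t,x) = ∫ (N(ω k)/(2 ω k)) exp(−i(ω k · t − ⟨k,x⟩)) dk` is
bounded on `ℝ × ℝ³`: for every `n : ℕ` there is `C > 0` bounding the norm of the
`n`-th iterated Fréchet derivative at every point. -/
theorem matter_piece_derivatives_bounded (m β : ℝ) (hm : 0 < m) (hβ : 0 < β) :
    ∀ n : ℕ, ∃ C : ℝ, 0 < C ∧ ∀ p : ℝ × EuclideanSpace ℝ (Fin 3),
      ‖iteratedFDeriv ℝ n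
        (fun q : ℝ × EuclideanSpace ℝ (Fin 3) =>
          ∫ k : EuclideanSpace ℝ (Fin 3),
            (((1 / (Real.exp (β * Real.sqrt (‖k‖ ^ 2 + m ^ 2)) - 1)) /
                (2 * Real.sqrt (‖k‖ ^ 2 + m ^ 2)) : ℝ) : ℂ) *
              Complex.exp (-Complex.I *
                ((Real.sqrt (‖k‖ ^ 2 + m ^ 2) * q.1 - ⟪k, q.2⟫ : ℝ) : ℂ))) p‖ ≤ C := by
  intro n
  let Φ : EuclideanSpace ℝ (Fin 3) → ℝ × EuclideanSpace ℝ (Fin 3) :=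
    fun k ↦ (Real.sqrt (‖k‖ ^ 2 + m ^ 2), k)
  let f : ℝ × EuclideanSpace ℝ (Fin 3) → ℂ :=
    fun v ↦ (((1 / (Real.exp (β * v.1) - 1)) / (2 * v.1) : ℝ) : ℂ)
  have hΦ : Measurable Φ := by fun_prop
  have hf : Measurable f := by fun_prop
  have hmoment : ∀ n : ℕ, Integrable (fun v ↦ ‖v‖ ^ n * ‖f v‖) (volume.map Φ) := by
    intro n
    rw [integrable_map_measure (Measurable.aestronglyMeasurable (by fun_prop)) hΦ.aemeasurable]
    refine (integrable_pow_mul_boseEinstein hm hβ n).norm.congr (.of_forall fun k ↦ ?_)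
    have hk : ‖k‖ ≤ Real.sqrt (‖k‖ ^ 2 + m ^ 2) :=
      Real.le_sqrt_of_sq_le (by nlinarith [sq_nonneg m])
    have hnorm : ‖Φ k‖ = Real.sqrt (‖k‖ ^ 2 + m ^ 2) := by
      rw [Prod.norm_def, Real.norm_of_nonneg (Real.sqrt_nonneg _), max_eq_left hk]
    simp only [Function.comp_apply, hnorm]
    rw [norm_mul, norm_pow, Real.norm_of_nonneg (Real.sqrt_nonneg _), Complex.norm_real]
  have hG : VectorFourier.fourierIntegral Real.fourierChar (volume.map Φ)
      (minkowskiPairing (EuclideanSpace ℝ (Fin 3))).toLinearMap₁₂ f =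
      fun q ↦ ∫ k : EuclideanSpace ℝ (Fin 3),
        (((1 / (Real.exp (β * Real.sqrt (‖k‖ ^ 2 + m ^ 2)) - 1)) /
            (2 * Real.sqrt (‖k‖ ^ 2 + m ^ 2)) : ℝ) : ℂ) *
          Complex.exp (-Complex.I *
            ((Real.sqrt (‖k‖ ^ 2 + m ^ 2) * q.1 - ⟪k, q.2⟫ : ℝ) : ℂ)) := by
    funext q
    have hcont : Continuous fun v ↦
        Real.fourierChar (-minkowskiPairing (EuclideanSpace ℝ (Fin 3)) v q) :=
      Real.continuous_fourierChar.comp (by fun_prop)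
    rw [VectorFourier.fourierIntegral, integral_map hΦ.aemeasurable]
    · refine integral_congr_ae (.of_forall fun k ↦ ?_)
      simp only [ContinuousLinearMap.toLinearMap₁₂_apply_apply_apply, Circle.smul_def,
        fourierChar_neg_minkowskiPairing, smul_eq_mul]
      exact mul_comm _ _
    · exact hcont.aestronglyMeasurable.smul hf.aestronglyMeasurable
  have key := exists_norm_iteratedFDeriv_fourierIntegral_le
    (minkowskiPairing (EuclideanSpace ℝ (Fin 3))) hmoment hf.aestronglyMeasurable n
  rw [hG] at key
  exact key
end

section
/- Fix m > 0, β > 0 and x ∈ ℝ³. The free thermal two-point function C^>(z, x) = ∫_{ℝ³} (1/(2 ω(k))) · ((1 + N(ω(k))) exp(−i(ω(k) z − ⟨k, x⟩)) + N(ω(k)) exp(i(ω(k) z − ⟨k, x⟩))) dk is well-defined (the integrand is Lebesgue integrable) for every complex z in the open strip {z ∈ ℂ : −β < Im z < 0}, and z ↦ C^>(z, x) is holomorphic on this strip. -/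
open MeasureTheory RealInnerProductSpace

/-- A decaying exponential of the norm is integrable on a finite-dimensional space. -/
theorem integrable_exp_neg_mul_norm {E : Type*} [NormedAddCommGroup E] [NormedSpace ℝ E]
    [FiniteDimensional ℝ E] [MeasurableSpace E] [BorelSpace E] (μ : Measure E)
    [μ.IsAddHaarMeasure] {δ : ℝ} (hδ : 0 < δ) :
    Integrable (fun k : E => Real.exp (-(δ * ‖k‖))) μ := by
  set n : ℕ := Module.finrank ℝ E + 1
  have hint : Integrable (fun k : E => (1 + ‖k‖) ^ (-(n : ℝ))) μ :=
    integrable_one_add_norm (by simp [n])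
  refine (hint.const_mul (Real.exp δ * n.factorial / δ ^ n)).mono' (by fun_prop) (.of_forall ?_)
  intro k
  have hk : 0 < 1 + ‖k‖ := by positivity
  have hexp := Real.pow_div_factorial_le_exp (δ * (1 + ‖k‖)) (by positivity) n
  rw [Real.norm_of_nonneg (Real.exp_pos _).le, Real.rpow_neg hk.le, Real.rpow_natCast,
    show -(δ * ‖k‖) = δ - δ * (1 + ‖k‖) by ring, Real.exp_sub, mul_div_assoc, mul_assoc,
    div_eq_mul_inv]
  gcongr
  refine (inv_anti₀ (by positivity) hexp).trans_eq ?_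
  rw [mul_pow, inv_div]
  field_simp

/-- The Bose-Einstein weights damp both exponentials in a closed substrip. -/
theorem boseEinstein_weighted_exp_le {m β δ w y : ℝ} (hm : 0 < m) (hβ : 0 < β) (hw : m ≤ w)
    (hy : δ - β ≤ y) (hy' : y ≤ -δ) :
    (1 + 1 / (Real.exp (β * w) - 1)) * Real.exp (w * y) +
        1 / (Real.exp (β * w) - 1) * Real.exp (-(w * y)) ≤
      (1 + 2 / (1 - Real.exp (-(β * m)))) * Real.exp (-(δ * w)) := by
  have hw0 : 0 < w := hm.trans_le hw
  have hd : 0 < 1 - Real.exp (-(β * m)) := by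
    rw [sub_pos, Real.exp_lt_one_iff]
    nlinarith
  have hden : 0 < Real.exp (β * w) - 1 := by
    rw [sub_pos, Real.one_lt_exp_iff]
    positivity
  have hN : 1 / (Real.exp (β * w) - 1) ≤
      1 / (1 - Real.exp (-(β * m))) * Real.exp (-(β * w)) := by
    rw [Real.exp_neg (β * w), ← div_eq_mul_inv, div_div]
    refine one_div_le_one_div_of_le (by positivity) ?_
    have h : 1 ≤ Real.exp (-(β * m)) * Real.exp (β * w) := by
      rw [← Real.exp_add, Real.one_le_exp_iff]
      nlinarith
    linarith
  have hN' : 1 / (Real.exp (β * w) - 1) ≤ 1 / (1 - Real.exp (-(β * m))) :=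
    hN.trans (mul_le_of_le_one_right (by positivity)
      (Real.exp_le_one_iff.2 (by nlinarith)))
  have h₁ : Real.exp (w * y) ≤ Real.exp (-(δ * w)) := Real.exp_le_exp.2 (by nlinarith)
  have h₂ : Real.exp (-(β * w)) * Real.exp (-(w * y)) ≤ Real.exp (-(δ * w)) := by
    rw [← Real.exp_add]
    exact Real.exp_le_exp.2 (by nlinarith)
  calc
    _ ≤ (1 + 1 / (1 - Real.exp (-(β * m)))) * Real.exp (-(δ * w)) +
        1 / (1 - Real.exp (-(β * m))) * Real.exp (-(β * w)) * Real.exp (-(w * y)) := by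
      gcongr
    _ ≤ (1 + 1 / (1 - Real.exp (-(β * m)))) * Real.exp (-(δ * w)) +
        1 / (1 - Real.exp (-(β * m))) * Real.exp (-(δ * w)) := by
      rw [mul_assoc _ (Real.exp (-(β * w)))]
      gcongr
    _ = _ := by ring

/-- The two thermal exponentials, combined with bounded coefficients `u` and `v`, decay
exponentially in `w` on a closed substrip. -/
theorem norm_thermal_combination_le {m β δ w p : ℝ} {z u v : ℂ} {c : ℝ} (hm : 0 < m)
    (hβ : 0 < β) (hw : m ≤ w) (hz : δ - β ≤ z.im) (hz' : z.im ≤ -δ) (hu : ‖u‖ ≤ c)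
    (hv : ‖v‖ ≤ c) :
    ‖u * (((1 + 1 / (Real.exp (β * w) - 1) : ℝ) : ℂ) *
          Complex.exp (-Complex.I * ((w : ℂ) * z - (p : ℂ)))) +
        v * (((1 / (Real.exp (β * w) - 1) : ℝ) : ℂ) *
          Complex.exp (Complex.I * ((w : ℂ) * z - (p : ℂ))))‖ ≤
      c * ((1 + 2 / (1 - Real.exp (-(β * m)))) * Real.exp (-(δ * w))) := by
  have hw0 : 0 < w := hm.trans_le hw
  have hden : 0 < Real.exp (β * w) - 1 := by
    rw [sub_pos, Real.one_lt_exp_iff]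
    positivity
  have hc : 0 ≤ c := (norm_nonneg u).trans hu
  refine (norm_add_le _ _).trans ?_
  have e₁ : (-Complex.I * ((w : ℂ) * z - (p : ℂ))).re = w * z.im := by simp
  have e₂ : (Complex.I * ((w : ℂ) * z - (p : ℂ))).re = -(w * z.im) := by simp
  rw [norm_mul, norm_mul, norm_mul, norm_mul, Complex.norm_exp, Complex.norm_exp, e₁, e₂,
    Complex.norm_of_nonneg (by positivity), Complex.norm_of_nonneg (by positivity)]
  refine le_trans ?_ (mul_le_mul_of_nonneg_left
    (boseEinstein_weighted_exp_le hm hβ hw hz hz') hc)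
  rw [mul_add]
  gcongr

/-- For `m > 0`, `β > 0` and fixed `x ∈ ℝ³`, the free thermal two-point
function `C^>(z,x) = ∫ (1/(2 ω k)) ((1 + N(ω k)) exp(−i(ω k z − ⟨k,x⟩))
+ N(ω k) exp(i(ω k z − ⟨k,x⟩))) dk` has a Lebesgue integrable integrand for every
`z` in the open strip `{z : −β < Im z < 0}`, and is holomorphic there. -/
theorem thermal_two_point_holomorphic_on_strip (m β : ℝ) (hm : 0 < m) (hβ : 0 < β)
    (x : EuclideanSpace ℝ (Fin 3)) :
    (∀ z : ℂ, -β < z.im → z.im < 0 →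
      Integrable (fun k : EuclideanSpace ℝ (Fin 3) =>
        ((1 / (2 * Real.sqrt (‖k‖ ^ 2 + m ^ 2)) : ℝ) : ℂ) *
          ((((1 + 1 / (Real.exp (β * Real.sqrt (‖k‖ ^ 2 + m ^ 2)) - 1) : ℝ)) : ℂ) *
              Complex.exp (-Complex.I *
                ((Real.sqrt (‖k‖ ^ 2 + m ^ 2) : ℂ) * z - ((⟪k, x⟫ : ℝ) : ℂ))) +
            (((1 / (Real.exp (β * Real.sqrt (‖k‖ ^ 2 + m ^ 2)) - 1) : ℝ)) : ℂ) *
              Complex.exp (Complex.I *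
                ((Real.sqrt (‖k‖ ^ 2 + m ^ 2) : ℂ) * z - ((⟪k, x⟫ : ℝ) : ℂ)))))) ∧
    DifferentiableOn ℂ
      (fun z : ℂ => ∫ k : EuclideanSpace ℝ (Fin 3),
        ((1 / (2 * Real.sqrt (‖k‖ ^ 2 + m ^ 2)) : ℝ) : ℂ) *
          ((((1 + 1 / (Real.exp (β * Real.sqrt (‖k‖ ^ 2 + m ^ 2)) - 1) : ℝ)) : ℂ) *
              Complex.exp (-Complex.I *
                ((Real.sqrt (‖k‖ ^ 2 + m ^ 2) : ℂ) * z - ((⟪k, x⟫ : ℝ) : ℂ))) +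
            (((1 / (Real.exp (β * Real.sqrt (‖k‖ ^ 2 + m ^ 2)) - 1) : ℝ)) : ℂ) *
              Complex.exp (Complex.I *
                ((Real.sqrt (‖k‖ ^ 2 + m ^ 2) : ℂ) * z - ((⟪k, x⟫ : ℝ) : ℂ)))))
      {z : ℂ | -β < z.im ∧ z.im < 0} := by
  set w : EuclideanSpace ℝ (Fin 3) → ℝ := fun k => Real.sqrt (‖k‖ ^ 2 + m ^ 2)
  have hwm : ∀ k, m ≤ w k := fun k => Real.le_sqrt_of_sq_le (by nlinarith [sq_nonneg ‖k‖])
  have hwk : ∀ k, ‖k‖ ≤ w k := fun k => Real.le_sqrt_of_sq_le (by nlinarith [sq_nonneg m])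
  have hw0 : ∀ k, 0 < w k := fun k => hm.trans_le (hwm k)
  have hw_meas : Measurable w := by fun_prop
  set A : EuclideanSpace ℝ (Fin 3) → ℂ → ℂ := fun k z =>
    ((1 + 1 / (Real.exp (β * w k) - 1) : ℝ) : ℂ) *
      Complex.exp (-Complex.I * ((w k : ℂ) * z - ((⟪k, x⟫ : ℝ) : ℂ))) with hA
  set B : EuclideanSpace ℝ (Fin 3) → ℂ → ℂ := fun k z =>
    ((1 / (Real.exp (β * w k) - 1) : ℝ) : ℂ) *
      Complex.exp (Complex.I * ((w k : ℂ) * z - ((⟪k, x⟫ : ℝ) : ℂ))) with hB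
  have hA_meas : ∀ z, Measurable fun k => A k z := fun z => by fun_prop
  have hB_meas : ∀ z, Measurable fun k => B k z := fun z => by fun_prop
  set D : ℝ := 1 + 2 / (1 - Real.exp (-(β * m)))
  have hD0 : 0 ≤ D := by
    have : Real.exp (-(β * m)) ≤ 1 := Real.exp_le_one_iff.2 (by nlinarith)
    have : 0 ≤ 1 - Real.exp (-(β * m)) := by linarith
    positivity
  have hbound : ∀ {δ c : ℝ} {k : EuclideanSpace ℝ (Fin 3)} {z u v : ℂ}, 0 < δ →
      δ - β ≤ z.im → z.im ≤ -δ → ‖u‖ ≤ c → ‖v‖ ≤ c →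
      ‖u * A k z + v * B k z‖ ≤ c * (D * Real.exp (-(δ * ‖k‖))) := by
    intro δ c k z u v hδ hz hz' hu hv
    have hc : 0 ≤ c := (norm_nonneg u).trans hu
    refine (norm_thermal_combination_le hm hβ (hwm k) hz hz' hu hv).trans ?_
    gcongr
    exact hwk k
  have hint : ∀ (δ c : ℝ), 0 < δ → Integrable fun k : EuclideanSpace ℝ (Fin 3) =>
      c * (D * Real.exp (-(δ * ‖k‖))) := fun δ c hδ =>
    ((integrable_exp_neg_mul_norm volume hδ).const_mul D).const_mul c
  have hInt : ∀ z : ℂ, -β < z.im → z.im < 0 → Integrable fun k =>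
      ((1 / (2 * w k) : ℝ) : ℂ) * (A k z + B k z) := by
    intro z hz hz'
    have hδ : 0 < min (z.im + β) (-z.im) := lt_min (by linarith) (by linarith)
    refine (hint _ (1 / (2 * m)) hδ).mono'
      ((Measurable.mul (by fun_prop) ((hA_meas z).add (hB_meas z))).aestronglyMeasurable)
      (.of_forall fun k => ?_)
    have hc : ‖((1 / (2 * w k) : ℝ) : ℂ)‖ ≤ 1 / (2 * m) := by
      have := hw0 k
      rw [Complex.norm_of_nonneg (by positivity)]
      gcongr
      exact hwm k
    rw [mul_add]
    exact hbound hδ (by linarith [min_le_left (z.im + β) (-z.im)])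
      (by linarith [min_le_right (z.im + β) (-z.im)]) hc hc
  refine ⟨hInt, fun z₀ hz₀ => ?_⟩
  obtain ⟨hz, hz'⟩ := hz₀
  obtain ⟨δ, hδ, hδ'⟩ : ∃ δ > 0, δ < min (z₀.im + β) (-z₀.im) :=
    exists_between (lt_min (by linarith) (by linarith))
  obtain ⟨hδl, hδr⟩ := lt_min_iff.1 hδ'
  have hs : {z : ℂ | δ - β < z.im ∧ z.im < -δ} ∈ nhds z₀ := by
    refine IsOpen.mem_nhds ?_ ⟨by linarith, by linarith⟩
    exact (isOpen_lt continuous_const Complex.continuous_im).inter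
      (isOpen_lt Complex.continuous_im continuous_const)
  have hderiv := hasDerivAt_integral_of_dominated_loc_of_deriv_le (μ := volume)
    (F := fun z k => ((1 / (2 * w k) : ℝ) : ℂ) * (A k z + B k z))
    (F' := fun z k => -Complex.I / 2 * A k z + Complex.I / 2 * B k z)
    (bound := fun k => 1 / 2 * (D * Real.exp (-(δ * ‖k‖)))) hs
    (.of_forall fun z =>
      (Measurable.mul (by fun_prop) ((hA_meas z).add (hB_meas z))).aestronglyMeasurable)
    (hInt z₀ hz hz')
    (((hA_meas z₀).const_mul _).add ((hB_meas z₀).const_mul _)).aestronglyMeasurable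
    (.of_forall fun k z h => hbound hδ h.1.le h.2.le (by simp) (by simp))
    (hint δ (1 / 2) hδ)
    (.of_forall fun k z _ => ?_)
  · exact hderiv.2.differentiableAt.differentiableWithinAt
  · have hwz : HasDerivAt (fun z : ℂ => (w k : ℂ) * z - ((⟪k, x⟫ : ℝ) : ℂ)) (w k) z := by
      simpa using ((hasDerivAt_id z).const_mul (w k : ℂ)).sub_const ((⟪k, x⟫ : ℝ) : ℂ)
    have hAd : HasDerivAt (A k) (-Complex.I * w k * A k z) z := by
      refine (((hwz.const_mul (-Complex.I)).cexp).const_mul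
        ((1 + 1 / (Real.exp (β * w k) - 1) : ℝ) : ℂ)).congr_deriv ?_
      simp only [hA]
      ring
    have hBd : HasDerivAt (B k) (Complex.I * w k * B k z) z := by
      refine (((hwz.const_mul Complex.I).cexp).const_mul
        ((1 / (Real.exp (β * w k) - 1) : ℝ) : ℂ)).congr_deriv ?_
      simp only [hB]
      ring
    have hwc : (w k : ℂ) ≠ 0 := Complex.ofReal_ne_zero.2 (hw0 k).ne'
    refine ((hAd.add hBd).const_mul ((1 / (2 * w k) : ℝ) : ℂ)).congr_deriv ?_
    push_cast
    field_simp
end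

section
/- Fix m > 0 and β > 0. The real-valued thermal correction h : ℝ × ℝ³ → ℝ, h(t, x) = ∫_{ℝ³} (N(ω(k)) / ω(k)) · cos(ω(k) t − ⟨k, x⟩) dk, is well-defined (the integrand is Lebesgue integrable for every (t, x)) and is an infinitely differentiable (C^∞) function on ℝ × ℝ³. -/
open MeasureTheory RealInnerProductSpace

/-- A cosine integral whose phase is linear in the parameter is smooth as soon as
all moments of its amplitude are finite. -/
theorem contDiff_integral_mul_cos {α V W : Type*} [MeasurableSpace α] {μ : Measure α}
    [NormedAddCommGroup V] [NormedSpace ℝ V] [MeasurableSpace V] [BorelSpace V]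
    [SecondCountableTopology V] [NormedAddCommGroup W] [NormedSpace ℝ W]
    (L : V →L[ℝ] W →L[ℝ] ℝ) {φ : α → V} (hφ : Measurable φ) {g : V → ℝ} (hg : Measurable g)
    (hmoment : ∀ n : ℕ, Integrable (fun a => ‖φ a‖ ^ n * ‖g (φ a)‖) μ) :
    ContDiff ℝ (⊤ : ℕ∞) (fun w => ∫ a, g (φ a) * Real.cos (L (φ a) w) ∂μ) := by
  have hgφ : Integrable (fun a => g (φ a)) μ := by
    refine (hmoment 0).mono (hg.comp hφ).aestronglyMeasurable (.of_forall fun a => ?_)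
    simp
  have hF : ContDiff ℝ (⊤ : ℕ∞) (VectorFourier.fourierIntegral Real.fourierChar (μ.map φ)
      (-(2 * Real.pi)⁻¹ • L).toLinearMap₁₂ (fun v => (g v : ℂ))) := by
    refine VectorFourier.contDiff_fourierIntegral _ fun n _ => ?_
    simp only [Complex.norm_real]
    rw [integrable_map_measure (by fun_prop) hφ.aemeasurable]
    exact hmoment n
  convert Complex.reCLM.contDiff.comp hF using 1
  ext w
  have hmeas : Measurable fun v => Complex.exp ((L v w : ℂ) * Complex.I) * (g v : ℂ) := by
    have : Measurable fun v => L v w := (by fun_prop : Continuous fun v => L v w).measurable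
    fun_prop
  have hval : VectorFourier.fourierIntegral Real.fourierChar (μ.map φ)
      (-(2 * Real.pi)⁻¹ • L).toLinearMap₁₂ (fun v => (g v : ℂ)) w =
      ∫ a, Complex.exp ((L (φ a) w : ℂ) * Complex.I) * (g (φ a) : ℂ) ∂μ := by
    rw [← integral_map hφ.aemeasurable hmeas.aestronglyMeasurable]
    refine integral_congr_ae (.of_forall fun v => ?_)
    have : 2 * Real.pi * (-(-(2 * Real.pi)⁻¹ * L v w)) = L v w := by
      field_simp
    simp only [Circle.smul_def, Real.fourierChar_apply, smul_eq_mul]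
    congr 3
    exact_mod_cast this
  have hexp : Integrable
      (fun a => Complex.exp ((L (φ a) w : ℂ) * Complex.I) * (g (φ a) : ℂ)) μ := by
    refine hgφ.mono (hmeas.comp hφ).aestronglyMeasurable (.of_forall fun a => ?_)
    simp [Complex.norm_exp_ofReal_mul_I]
  simp only [Function.comp_apply, hval]
  rw [← ContinuousLinearMap.integral_comp_comm _ hexp]
  refine integral_congr_ae (.of_forall fun a => ?_)
  simp [Complex.exp_ofReal_mul_I_re, mul_comm (g (φ a))]

theorem pow_div_factorial_le_exp_sub_one {x : ℝ} (hx : 0 ≤ x) {p : ℕ} (hp : p ≠ 0) :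
    x ^ p / p.factorial ≤ Real.exp x - 1 := by
  obtain ⟨q, rfl⟩ := Nat.exists_eq_add_one_of_ne_zero hp
  have h := Real.sum_le_exp_of_nonneg hx (q + 2)
  rw [Finset.sum_range_succ, Finset.sum_range_succ'] at h
  have : 0 ≤ ∑ i ∈ Finset.range q, x ^ (i + 1) / ((i + 1).factorial : ℝ) :=
    Finset.sum_nonneg fun i _ => by positivity
  simp only [pow_zero, Nat.factorial_zero, Nat.cast_one, div_one] at h
  linarith

/-- The Bose–Einstein weight `N(E) / E` decays faster than any power. -/
theorem pow_mul_boseEinstein_div_le {β E : ℝ} (hβ : 0 < β) (hE : 0 < E) (n : ℕ) :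
    E ^ n * (1 / (Real.exp (β * E) - 1) / E) ≤
      (n + 3).factorial / β ^ (n + 3) * (E ^ 4)⁻¹ := by
  have h := pow_div_factorial_le_exp_sub_one (x := β * E) (by positivity) (p := n + 3) (by simp)
  calc E ^ n * (1 / (Real.exp (β * E) - 1) / E)
      ≤ E ^ n * (1 / ((β * E) ^ (n + 3) / (n + 3).factorial) / E) := by
        gcongr
    _ = (n + 3).factorial / β ^ (n + 3) * (E ^ 4)⁻¹ := by
        field_simp
        ring

theorem integrable_inv_sqrt_norm_sq_add_sq_pow_four {m : ℝ} (hm : 0 < m) :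
    Integrable (fun k : EuclideanSpace ℝ (Fin 3) => (Real.sqrt (‖k‖ ^ 2 + m ^ 2) ^ 4)⁻¹) := by
  have h := integrable_rpow_neg_one_add_norm_sq (E := EuclideanSpace ℝ (Fin 3))
    (μ := volume) (r := 4) (by simp; norm_num)
  have hc : 0 < min 1 (m ^ 2) := by positivity
  refine (h.const_mul ((min 1 (m ^ 2)) ^ 2)⁻¹).mono' (by fun_prop) (.of_forall fun k => ?_)
  have hle : min 1 (m ^ 2) * (1 + ‖k‖ ^ 2) ≤ ‖k‖ ^ 2 + m ^ 2 := by
    nlinarith [min_le_left 1 (m ^ 2), min_le_right 1 (m ^ 2), sq_nonneg ‖k‖]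
  have hpow : (1 + ‖k‖ ^ 2) ^ (-(4 : ℝ) / 2) = ((1 + ‖k‖ ^ 2) ^ 2)⁻¹ := by
    rw [show -(4 : ℝ) / 2 = -(2 : ℕ) by norm_num, Real.rpow_neg (by positivity),
      Real.rpow_natCast]
  have hsqrt : Real.sqrt (‖k‖ ^ 2 + m ^ 2) ^ 4 = (‖k‖ ^ 2 + m ^ 2) ^ 2 := by
    rw [show 4 = 2 * 2 from rfl, pow_mul, Real.sq_sqrt (by positivity)]
  rw [hpow, hsqrt, Real.norm_of_nonneg (by positivity), ← mul_inv, ← mul_pow]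
  gcongr

/-- For `m > 0` and `β > 0`, the real-valued thermal correction
`h(t,x) = ∫ (N(ω k)/ω k) cos(ω k · t − ⟨k,x⟩) dk` has a Lebesgue integrable
integrand for every `(t,x)` and defines a `C^∞` function on `ℝ × ℝ³`. -/
theorem thermal_correction_integrable_and_smooth (m β : ℝ) (hm : 0 < m) (hβ : 0 < β) :
    (∀ (t : ℝ) (x : EuclideanSpace ℝ (Fin 3)),
      Integrable (fun k : EuclideanSpace ℝ (Fin 3) =>
        (1 / (Real.exp (β * Real.sqrt (‖k‖ ^ 2 + m ^ 2)) - 1)) /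
            Real.sqrt (‖k‖ ^ 2 + m ^ 2) *
          Real.cos (Real.sqrt (‖k‖ ^ 2 + m ^ 2) * t - ⟪k, x⟫))) ∧
    ContDiff ℝ (⊤ : ℕ∞) (fun p : ℝ × EuclideanSpace ℝ (Fin 3) =>
      ∫ k : EuclideanSpace ℝ (Fin 3),
        (1 / (Real.exp (β * Real.sqrt (‖k‖ ^ 2 + m ^ 2)) - 1)) /
            Real.sqrt (‖k‖ ^ 2 + m ^ 2) *
          Real.cos (Real.sqrt (‖k‖ ^ 2 + m ^ 2) * p.1 - ⟪k, p.2⟫)) := by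
  have hω : ∀ k : EuclideanSpace ℝ (Fin 3), 0 < Real.sqrt (‖k‖ ^ 2 + m ^ 2) :=
    fun k => Real.sqrt_pos.2 (by positivity)
  let φ : EuclideanSpace ℝ (Fin 3) → ℝ × EuclideanSpace ℝ (Fin 3) :=
    fun k => (Real.sqrt (‖k‖ ^ 2 + m ^ 2), k)
  let g : ℝ × EuclideanSpace ℝ (Fin 3) → ℝ := fun v => 1 / (Real.exp (β * v.1) - 1) / v.1
  let L : ℝ × EuclideanSpace ℝ (Fin 3) →L[ℝ] ℝ × EuclideanSpace ℝ (Fin 3) →L[ℝ] ℝ :=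
    (ContinuousLinearMap.mul ℝ ℝ).bilinearComp (.fst ℝ _ _) (.fst ℝ _ _) -
      (innerSL ℝ).bilinearComp (.snd ℝ _ _) (.snd ℝ _ _)
  have hφ : Measurable φ := by fun_prop
  have hg : Measurable g := by fun_prop
  have hnorm : ∀ k, ‖φ k‖ ≤ Real.sqrt (‖k‖ ^ 2 + m ^ 2) := fun k => by
    refine max_le (Real.norm_of_nonneg (hω k).le).le (Real.le_sqrt_of_sq_le ?_)
    nlinarith [sq_nonneg m]
  have hg_nonneg : ∀ k, 0 ≤ g (φ k) := fun k => by
    have : 0 ≤ Real.exp (β * Real.sqrt (‖k‖ ^ 2 + m ^ 2)) - 1 := by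
      rw [sub_nonneg, Real.one_le_exp_iff]
      positivity
    exact div_nonneg (one_div_nonneg.2 this) (hω k).le
  have hmoment : ∀ n : ℕ, Integrable (fun k => ‖φ k‖ ^ n * ‖g (φ k)‖) := fun n => by
    refine ((integrable_inv_sqrt_norm_sq_add_sq_pow_four hm).const_mul
      ((n + 3).factorial / β ^ (n + 3))).mono' ?_ (.of_forall fun k => ?_)
    · exact ((hφ.norm.pow_const n).mul (hg.comp hφ).norm).aestronglyMeasurable
    rw [Real.norm_of_nonneg (by positivity), Real.norm_of_nonneg (hg_nonneg k)]
    exact (mul_le_mul_of_nonneg_right (pow_le_pow_left₀ (norm_nonneg _) (hnorm k) n)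
      (hg_nonneg k)).trans (pow_mul_boseEinstein_div_le hβ (hω k) n)
  refine ⟨fun t x => ?_, contDiff_integral_mul_cos L hφ hg hmoment⟩
  refine (hmoment 0).mono (by fun_prop) (.of_forall fun k => ?_)
  rw [pow_zero, one_mul, norm_norm, norm_mul]
  exact mul_le_of_le_one_right (norm_nonneg _) (Real.abs_cos_le_one _)
end
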